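/- Let 𝔸 = (A_n)_{n∈ℕ} be a sequence of invertible linear operators on ℝ^d and 𝒮 = (‖·‖_n)_{n∈ℕ} a sequence of norms on ℝ^d for which there exist K,a>0 such that ‖𝒜(m,n)x‖_m ≤ K(m/n)^a‖x‖_n and ‖𝒜(n,m)x‖_n ≤ K(m/n)^a‖x‖_m for all m≥n in ℕ and x∈ℝ^d. Let B_n := 𝒜(2^{n+1},2^n) for n∈ℤ⁺, 𝔹 = (B_n)_{n∈ℤ⁺}, and 𝒮̃ = (‖·‖_{2^n})_{n∈ℤ⁺}. Then for every τ∈ℝ: τ ∈ Σ_{PD,𝔸,𝒮} if and only if 2^τ ∈ Σ_{ED,𝔹,𝒮̃}. -/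

import Mathlib

noncomputable section

namespace NonautLin

variable {E : Type*} [NormedAddCommGroup E] [NormedSpace ℝ E]

/-- `N : E → ℝ` is a norm on the real vector space `E`. -/
def IsNormOn (N : E → ℝ) : Prop :=
  (∀ x, 0 ≤ N x) ∧ (∀ x, N x = 0 ↔ x = 0) ∧
  (∀ (c : ℝ) (x : E), N (c • x) = |c| * N x) ∧
  (∀ x y : E, N (x + y) ≤ N x + N y)

/-- Multiplication by the scalar `c` as a continuous linear equivalence
(junk value `id` for `c = 0`). -/
def smulCLE (c : ℝ) : E ≃L[ℝ] E :=
  if hc : c = 0 then ContinuousLinearEquiv.refl ℝ E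
  else
    { toFun := fun x => c • x
      invFun := fun x => c⁻¹ • x
      map_add' := fun x y => smul_add c x y
      map_smul' := fun a x => smul_comm c a x
      left_inv := fun x => by simp [smul_smul, inv_mul_cancel₀ hc]
      right_inv := fun x => by simp [smul_smul, mul_inv_cancel₀ hc]
      continuous_toFun := continuous_const_smul c
      continuous_invFun := continuous_const_smul c⁻¹ }

/-- The operator `c • A` as a continuous linear equivalence. -/
def scale (c : ℝ) (A : E ≃L[ℝ] E) : E ≃L[ℝ] E := A.trans (smulCLE c)

/-- `fwd A n k` is the composition `A (n+k-1) ∘ ⋯ ∘ A n`. -/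
def fwd (A : ℕ → (E ≃L[ℝ] E)) (n : ℕ) : ℕ → (E ≃L[ℝ] E)
  | 0 => ContinuousLinearEquiv.refl ℝ E
  | k + 1 => (fwd A n k).trans (A (n + k))

/-- The cocycle `𝒜(m,n)` associated with the one-sided sequence `A`:
`𝒜(m,n) = A (m-1) ∘ ⋯ ∘ A n` for `m > n`, `𝒜(n,n) = Id`, and
`𝒜(m,n) = (𝒜(n,m))⁻¹` for `m < n`. -/
def coc (A : ℕ → (E ≃L[ℝ] E)) (m n : ℕ) : E ≃L[ℝ] E :=
  if n ≤ m then fwd A n (m - n) else (fwd A m (n - m)).symm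

/-- Nonuniform strong polynomial dichotomy (indices `n ≥ 1`), with nonuniformity
exponent `eps`. -/
def NonuniformStrongPolyDichotomyWith (A : ℕ → (E ≃L[ℝ] E)) (eps : ℝ) : Prop :=
  ∃ K lam a : ℝ, 0 < K ∧ 0 < lam ∧ lam ≤ a ∧
    ∃ P : ℕ → (E →L[ℝ] E),
      (∀ n, 1 ≤ n → (P n).comp (P n) = P n) ∧
      (∀ n, 1 ≤ n → ((A n : E →L[ℝ] E)).comp (P n) = (P (n + 1)).comp (A n : E →L[ℝ] E)) ∧
      (∀ m n : ℕ, 1 ≤ n → n ≤ m →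
        ‖((coc A m n : E →L[ℝ] E)).comp (P n)‖ ≤ K * ((m : ℝ) / n) ^ (-lam) * (n : ℝ) ^ eps ∧
        ‖((coc A n m : E →L[ℝ] E)).comp (ContinuousLinearMap.id ℝ E - P m)‖
          ≤ K * ((m : ℝ) / n) ^ (-lam) * (m : ℝ) ^ eps ∧
        ‖(coc A m n : E →L[ℝ] E)‖ ≤ K * ((m : ℝ) / n) ^ a * (n : ℝ) ^ eps ∧
        ‖(coc A n m : E →L[ℝ] E)‖ ≤ K * ((m : ℝ) / n) ^ a * (m : ℝ) ^ eps)

/-- Nonuniform strong polynomial dichotomy (indices `n ≥ 1`). -/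
def NonuniformStrongPolyDichotomy (A : ℕ → (E ≃L[ℝ] E)) : Prop :=
  ∃ eps : ℝ, 0 ≤ eps ∧ NonuniformStrongPolyDichotomyWith A eps

/-- Strong polynomial dichotomy with respect to a sequence of norms (indices `n ≥ 1`). -/
def StrongPolyDichotomyWRT (A : ℕ → (E ≃L[ℝ] E)) (N : ℕ → E → ℝ) : Prop :=
  ∃ K lam a : ℝ, 0 < K ∧ 0 < lam ∧ lam ≤ a ∧
    ∃ P : ℕ → (E →L[ℝ] E),
      (∀ n, 1 ≤ n → (P n).comp (P n) = P n) ∧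
      (∀ n, 1 ≤ n → ((A n : E →L[ℝ] E)).comp (P n) = (P (n + 1)).comp (A n : E →L[ℝ] E)) ∧
      (∀ m n : ℕ, 1 ≤ n → n ≤ m → ∀ x : E,
        N m (coc A m n (P n x)) ≤ K * ((m : ℝ) / n) ^ (-lam) * N n x ∧
        N n (coc A n m (x - P m x)) ≤ K * ((m : ℝ) / n) ^ (-lam) * N m x ∧
        N m (coc A m n x) ≤ K * ((m : ℝ) / n) ^ a * N n x ∧
        N n (coc A n m x) ≤ K * ((m : ℝ) / n) ^ a * N m x)

/-- Strong exponential dichotomy, over `ℤ⁺`, with respect to a sequence of norms and a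
given sequence of projections. -/
def StrongExpDichotomyWRTProj (B : ℕ → (E ≃L[ℝ] E)) (N : ℕ → E → ℝ)
    (P : ℕ → (E →L[ℝ] E)) : Prop :=
  ∃ K lam a : ℝ, 0 < K ∧ 0 < lam ∧ lam ≤ a ∧
    (∀ n, (P n).comp (P n) = P n) ∧
    (∀ n, ((B n : E →L[ℝ] E)).comp (P n) = (P (n + 1)).comp (B n : E →L[ℝ] E)) ∧
    (∀ m n : ℕ, n ≤ m → ∀ x : E,
      N m (coc B m n (P n x)) ≤ K * Real.exp (-lam * ((m : ℝ) - n)) * N n x ∧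
      N n (coc B n m (x - P m x)) ≤ K * Real.exp (-lam * ((m : ℝ) - n)) * N m x ∧
      N m (coc B m n x) ≤ K * Real.exp (a * ((m : ℝ) - n)) * N n x ∧
      N n (coc B n m x) ≤ K * Real.exp (a * ((m : ℝ) - n)) * N m x)

/-- Strong exponential dichotomy, over `ℤ⁺`, with respect to a sequence of norms. -/
def StrongExpDichotomyWRT (B : ℕ → (E ≃L[ℝ] E)) (N : ℕ → E → ℝ) : Prop :=
  ∃ P : ℕ → (E →L[ℝ] E), StrongExpDichotomyWRTProj B N P

/-- The exponential dichotomy spectrum over `ℤ⁺`: the set of `τ > 0` such that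
`((1/τ) B_n)` does not admit a strong exponential dichotomy w.r.t. the norms `N`. -/
def SigmaED (B : ℕ → (E ≃L[ℝ] E)) (N : ℕ → E → ℝ) : Set ℝ :=
  {τ | 0 < τ ∧ ¬ StrongExpDichotomyWRT (fun n => scale τ⁻¹ (B n)) N}

/-- The polynomial dichotomy spectrum: the set of `τ ∈ ℝ` such that
`(((n+1)/n)^{-τ} A_n)` does not admit a strong polynomial dichotomy w.r.t. `N`. -/
def SigmaPD (A : ℕ → (E ≃L[ℝ] E)) (N : ℕ → E → ℝ) : Set ℝ :=
  {τ | ¬ StrongPolyDichotomyWRT (fun n => scale ((((n : ℝ) + 1) / n) ^ (-τ)) (A n)) N}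

theorem smulCLE_apply {c : ℝ} (hc : c ≠ 0) (x : E) : smulCLE c x = c • x := by
  simp only [smulCLE, dif_neg hc]
  rfl

theorem scale_apply {c : ℝ} (hc : c ≠ 0) (A : E ≃L[ℝ] E) (x : E) :
    scale c A x = c • A x := by
  simp [scale, smulCLE_apply hc]

theorem fwd_add (A : ℕ → (E ≃L[ℝ] E)) (l n k : ℕ) (x : E) :
    fwd A (l + n) k (fwd A l n x) = fwd A l (n + k) x := by
  induction k with
  | zero => rfl
  | succ k ih =>
    rw [← add_assoc]
    simp only [fwd, ContinuousLinearEquiv.trans_apply]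
    rw [ih, add_assoc]

theorem coc_apply (A : ℕ → (E ≃L[ℝ] E)) (m n : ℕ) (x : E) :
    coc A m n x = fwd A 0 m ((fwd A 0 n).symm x) := by
  unfold coc
  split_ifs with h
  · have := fwd_add A 0 n (m - n) ((fwd A 0 n).symm x)
    rwa [zero_add, Nat.add_sub_cancel' h, ContinuousLinearEquiv.apply_symm_apply] at this
  · have := fwd_add A 0 m (n - m) ((fwd A 0 n).symm x)
    rw [zero_add, Nat.add_sub_cancel' (by omega), ContinuousLinearEquiv.apply_symm_apply] at this
    rw [ContinuousLinearEquiv.symm_apply_eq, this]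

theorem coc_coc (A : ℕ → (E ≃L[ℝ] E)) (m n k : ℕ) (x : E) :
    coc A m n (coc A n k x) = coc A m k x := by
  simp [coc_apply]

@[simp]
theorem coc_self (A : ℕ → (E ≃L[ℝ] E)) (n : ℕ) (x : E) : coc A n n x = x := by
  simp [coc_apply]

theorem coc_succ_self (A : ℕ → (E ≃L[ℝ] E)) (n : ℕ) (x : E) : coc A (n + 1) n x = A n x := by
  simp [coc, fwd]

theorem coc_succ (A : ℕ → (E ≃L[ℝ] E)) (m n : ℕ) (x : E) :
    coc A (m + 1) n x = A m (coc A m n x) := by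
  rw [← coc_coc A (m + 1) m n, coc_succ_self]

theorem coc_eq_of_coc_eq {A B : ℕ → (E ≃L[ℝ] E)} {m n : ℕ} {c : ℝ} (hc : c ≠ 0)
    (h : ∀ x, coc B m n x = c • coc A m n x) (x : E) :
    coc B n m x = c⁻¹ • coc A n m x := by
  have h' := h (c⁻¹ • coc A n m x)
  rw [map_smul (coc A m n), coc_coc, coc_self, smul_smul, mul_inv_cancel₀ hc, one_smul] at h'
  rw [← coc_self B n (c⁻¹ • coc A n m x), ← coc_coc B n m n, h']

/-- The cocycle of a dyadic subsequence of a cocycle. -/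
theorem coc_dyadic (A : ℕ → (E ≃L[ℝ] E)) (m n : ℕ) (x : E) :
    coc (fun n => coc A (2 ^ (n + 1)) (2 ^ n)) m n x = coc A (2 ^ m) (2 ^ n) x := by
  have key : ∀ k (x : E), fwd (fun n => coc A (2 ^ (n + 1)) (2 ^ n)) 0 k x
      = coc A (2 ^ k) (2 ^ 0) x := by
    intro k
    induction k with
    | zero => intro x; rw [coc_self]; rfl
    | succ k ih =>
      intro x
      simp only [fwd, ContinuousLinearEquiv.trans_apply]
      rw [ih, zero_add, coc_coc]
  rw [coc_apply, key]
  have h := key n ((fwd (fun n => coc A (2 ^ (n + 1)) (2 ^ n)) 0 n).symm x)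
  rw [ContinuousLinearEquiv.apply_symm_apply] at h
  conv_rhs => rw [h]
  rw [coc_coc]

theorem coc_scale (A : ℕ → (E ≃L[ℝ] E)) (τ : ℝ) {m n : ℕ} (hn : 1 ≤ n) (hnm : n ≤ m) (x : E) :
    coc (fun n : ℕ => scale ((((n : ℝ) + 1) / n) ^ (-τ)) (A n)) m n x
      = ((m : ℝ) / n) ^ (-τ) • coc A m n x := by
  have hn0 : (0 : ℝ) < n := by exact_mod_cast hn
  induction m, hnm using Nat.le_induction with
  | base => simp [div_self hn0.ne']
  | succ m hnm ih =>
    have hm0 : (0 : ℝ) < m := by exact_mod_cast hn.trans hnm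
    rw [coc_succ, ih, scale_apply (by positivity), map_smul, smul_smul, coc_succ,
      ← Real.mul_rpow (by positivity) (by positivity)]
    congr 2
    push_cast
    field_simp

theorem scale_coc_dyadic (A : ℕ → (E ≃L[ℝ] E)) (τ : ℝ) (n : ℕ) :
    scale ((2 : ℝ) ^ τ)⁻¹ (coc A (2 ^ (n + 1)) (2 ^ n)) =
      coc (fun n : ℕ => scale ((((n : ℝ) + 1) / n) ^ (-τ)) (A n)) (2 ^ (n + 1)) (2 ^ n) := by
  ext1
  funext x
  rw [coc_scale A τ Nat.one_le_two_pow (Nat.pow_le_pow_right two_pos n.le_succ),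
    scale_apply (by positivity), ← Real.rpow_neg two_pos.le]
  congr 2
  push_cast
  rw [pow_succ]
  field_simp

/-- Polynomial growth of a cocycle, forward and backward, with respect to a sequence of norms. -/
def PolyBounded (A : ℕ → (E ≃L[ℝ] E)) (N : ℕ → E → ℝ) (K a : ℝ) : Prop :=
  ∀ m n : ℕ, 1 ≤ n → n ≤ m → ∀ x : E,
    N m (coc A m n x) ≤ K * ((m : ℝ) / n) ^ a * N n x ∧
    N n (coc A n m x) ≤ K * ((m : ℝ) / n) ^ a * N m x

theorem PolyBounded.scale {A : ℕ → (E ≃L[ℝ] E)} {N : ℕ → E → ℝ} {K a : ℝ}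
    (h : PolyBounded A N K a) (hN : ∀ n : ℕ, 1 ≤ n → IsNormOn (N n)) (hK : 0 < K) (τ : ℝ) :
    PolyBounded (fun n : ℕ => scale ((((n : ℝ) + 1) / n) ^ (-τ)) (A n)) N K (a + |τ|) := by
  intro m n hn hnm x
  have hn0 : (0 : ℝ) < n := by exact_mod_cast hn
  have hr : (1 : ℝ) ≤ (m : ℝ) / n := by
    rw [one_le_div hn0]
    exact_mod_cast hnm
  have hr0 : (0 : ℝ) < (m : ℝ) / n := zero_lt_one.trans_le hr
  have hm : 1 ≤ m := hn.trans hnm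
  obtain ⟨h1, h2⟩ := h m n hn hnm x
  have aux : ∀ s y z : ℝ, s ≤ |τ| → y ≤ K * ((m : ℝ) / n) ^ a * z → 0 ≤ z →
      |((m : ℝ) / n) ^ s| * y ≤ K * ((m : ℝ) / n) ^ (a + |τ|) * z := by
    intro s y z hs hy hz
    rw [abs_of_pos (by positivity), Real.rpow_add hr0]
    calc ((m : ℝ) / n) ^ s * y ≤ ((m : ℝ) / n) ^ s * (K * ((m : ℝ) / n) ^ a * z) := by gcongr
      _ ≤ ((m : ℝ) / n) ^ |τ| * (K * ((m : ℝ) / n) ^ a * z) := by gcongr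
      _ = _ := by ring
  constructor
  · rw [coc_scale A τ hn hnm, (hN m hm).2.2.1]
    exact aux _ _ _ (neg_le_abs τ) h1 ((hN n hn).1 x)
  · rw [coc_eq_of_coc_eq (by positivity) (coc_scale A τ hn hnm), (hN n hn).2.2.1,
      ← Real.rpow_neg hr0.le, neg_neg]
    exact aux _ _ _ (le_abs_self τ) h2 ((hN m hm).1 x)

theorem two_pow_div_rpow (m n : ℕ) (s : ℝ) :
    (((2 ^ m : ℕ) : ℝ) / (2 ^ n : ℕ)) ^ s = Real.exp (s * Real.log 2 * ((m : ℝ) - n)) := by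
  rw [Real.rpow_def_of_pos (by positivity), Real.log_div (by positivity) (by positivity)]
  push_cast
  rw [Real.log_pow, Real.log_pow]
  ring_nf

theorem StrongPolyDichotomyWRT.dyadic {A : ℕ → (E ≃L[ℝ] E)} {N : ℕ → E → ℝ}
    (h : StrongPolyDichotomyWRT A N) :
    StrongExpDichotomyWRT (fun n => coc A (2 ^ (n + 1)) (2 ^ n)) (fun n => N (2 ^ n)) := by
  obtain ⟨K, lam, a, hK, hlam, hla, P, hP, hAP, hb⟩ := h
  have hlog : 0 < Real.log 2 := Real.log_pos one_lt_two
  have hcomm : ∀ m n : ℕ, 1 ≤ n → n ≤ m → ∀ x, coc A m n (P n x) = P m (coc A m n x) := by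
    intro m n hn hnm x
    induction m, hnm using Nat.le_induction with
    | base => simp
    | succ m hnm ih =>
      rw [coc_succ, ih, coc_succ]
      exact DFunLike.congr_fun (hAP m (hn.trans hnm)) (coc A m n x)
  refine ⟨fun n => P (2 ^ n), K, lam * Real.log 2, a * Real.log 2, hK, by positivity, by gcongr,
    fun n => hP _ Nat.one_le_two_pow, fun n => ?_, fun m n hnm x => ?_⟩
  · ext1 x
    exact hcomm _ _ Nat.one_le_two_pow (Nat.pow_le_pow_right two_pos n.le_succ) x
  · have := hb (2 ^ m) (2 ^ n) Nat.one_le_two_pow (Nat.pow_le_pow_right two_pos hnm) x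
    simp only [two_pow_div_rpow] at this
    simpa only [coc_dyadic, neg_mul] using this

/-- The polynomial rate between two integers is comparable with the exponential rate between
their binary logarithms. -/
theorem exp_log_two_le {lam : ℝ} (hlam : 0 < lam) {m n : ℕ} (hn : 1 ≤ n) (hnm : n ≤ m) :
    Real.exp (-lam * ((Nat.log 2 m : ℝ) - Nat.log 2 n))
      ≤ Real.exp lam * ((m : ℝ) / n) ^ (-(lam / Real.log 2)) := by
  have hlog : 0 < Real.log 2 := Real.log_pos one_lt_two
  have hn0 : (0 : ℝ) < n := by exact_mod_cast hn
  have hm0 : (0 : ℝ) < m := by exact_mod_cast hn.trans hnm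
  have h1 : Real.log m ≤ (Nat.log 2 m + 1) * Real.log 2 := by
    have : (m : ℝ) ≤ 2 ^ (Nat.log 2 m + 1) := by
      exact_mod_cast (Nat.lt_pow_succ_log_self one_lt_two m).le
    have := Real.log_le_log hm0 this
    rw [Real.log_pow] at this
    exact_mod_cast this
  have h2 : Nat.log 2 n * Real.log 2 ≤ Real.log n := by
    have : (2 : ℝ) ^ Nat.log 2 n ≤ n := by
      exact_mod_cast Nat.pow_log_le_self 2 (by omega)
    have := Real.log_le_log (by positivity) this
    rwa [Real.log_pow] at this
  rw [Real.rpow_def_of_pos (by positivity), ← Real.exp_add, Real.exp_le_exp,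
    Real.log_div hm0.ne' hn0.ne']
  have h3 : (Real.log m - Real.log n) / Real.log 2 ≤ Nat.log 2 m + 1 - Nat.log 2 n := by
    rw [div_le_iff₀ hlog]
    linarith
  have h4 := mul_le_mul_of_nonneg_left h3 hlam.le
  have h5 : (Real.log m - Real.log n) * -(lam / Real.log 2)
      = -(lam * ((Real.log m - Real.log n) / Real.log 2)) := by ring
  rw [h5]
  linarith

theorem div_two_pow_log_rpow_le {n : ℕ} (hn : 1 ≤ n) {a : ℝ} (ha : 0 < a) :
    ((n : ℝ) / (2 ^ Nat.log 2 n : ℕ)) ^ a ≤ 2 ^ a := by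
  gcongr
  rw [div_le_iff₀ (by positivity)]
  have := (Nat.lt_pow_succ_log_self one_lt_two n).le
  rw [pow_succ, mul_comm] at this
  exact_mod_cast this

theorem StrongExpDichotomyWRT.of_dyadic {A : ℕ → (E ≃L[ℝ] E)} {N : ℕ → E → ℝ} {K a : ℝ}
    (hN : ∀ n : ℕ, 1 ≤ n → ∀ x, 0 ≤ N n x) (hK : 0 < K) (ha : 0 < a) (hA : PolyBounded A N K a)
    (h : StrongExpDichotomyWRT (fun n => coc A (2 ^ (n + 1)) (2 ^ n)) (fun n => N (2 ^ n))) :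
    StrongPolyDichotomyWRT A N := by
  obtain ⟨P, L, lam, b, hL, hlam, -, hP, hBP, hb⟩ := h
  have hlog : 0 < Real.log 2 := Real.log_pos one_lt_two
  set Q : ℕ → (E →L[ℝ] E) := fun n =>
    (coc A n 1 : E →L[ℝ] E).comp ((P 0).comp (coc A 1 n : E →L[ℝ] E))
  have hQx : ∀ n x, Q n x = coc A n 1 (P 0 (coc A 1 n x)) := fun _ _ => rfl
  have hcomm : ∀ m n x, coc A m n (Q n x) = Q m (coc A m n x) := by
    intro m n x
    rw [hQx, hQx, coc_coc, coc_coc]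
  have hPQ : ∀ n x, P n x = Q (2 ^ n) x := by
    intro n
    induction n with
    | zero => intro x; simp [hQx]
    | succ n ih =>
      intro x
      have h1 := DFunLike.congr_fun (hBP n) (coc A (2 ^ n) (2 ^ (n + 1)) x)
      simp only [ContinuousLinearMap.comp_apply, ContinuousLinearEquiv.coe_coe, coc_coc,
        coc_self] at h1
      rw [← h1, ih, hcomm, coc_coc, coc_self]
  have hcommQ : ∀ m n x, coc A m n (x - Q n x) = coc A m n x - Q m (coc A m n x) := by
    intro m n x
    rw [map_sub, hcomm]
  set M : ℝ := K * 2 ^ a * L * (K * 2 ^ a) * Real.exp lam with hM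
  have hM0 : 0 < M := by positivity
  have near : ∀ n : ℕ, 1 ≤ n → ∀ x,
      N n (coc A n (2 ^ Nat.log 2 n) x) ≤ K * 2 ^ a * N (2 ^ Nat.log 2 n) x ∧
      N (2 ^ Nat.log 2 n) (coc A (2 ^ Nat.log 2 n) n x) ≤ K * 2 ^ a * N n x := by
    intro n hn x
    obtain ⟨h1, h2⟩ := hA n (2 ^ Nat.log 2 n) Nat.one_le_two_pow
      (Nat.pow_log_le_self 2 (by omega)) x
    have h3 := div_two_pow_log_rpow_le hn ha
    exact ⟨h1.trans (by gcongr; exact hN _ Nat.one_le_two_pow x),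
      h2.trans (by gcongr; exact hN _ hn x)⟩
  have chain : ∀ w₁ w₂ w₃ w₄ e r : ℝ, w₁ ≤ K * 2 ^ a * w₂ → w₂ ≤ L * e * w₃ →
      w₃ ≤ K * 2 ^ a * w₄ → 0 ≤ e → e ≤ Real.exp lam * r → 0 ≤ r → 0 ≤ w₄ →
      w₁ ≤ (K + M) * r * w₄ := by
    intro w₁ w₂ w₃ w₄ e r h1 h2 h3 he her hr hw
    calc w₁ ≤ K * 2 ^ a * w₂ := h1
      _ ≤ K * 2 ^ a * (L * e * w₃) := by gcongr
      _ ≤ K * 2 ^ a * (L * e * (K * 2 ^ a * w₄)) := by gcongr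
      _ ≤ K * 2 ^ a * (L * (Real.exp lam * r) * (K * 2 ^ a * w₄)) := by gcongr
      _ = M * r * w₄ := by rw [hM]; ring
      _ ≤ (K + M) * r * w₄ := by gcongr; linarith
  refine ⟨K + M, lam / Real.log 2, max a (lam / Real.log 2), by positivity, by positivity,
    le_max_right _ _, Q, fun n _ => ?_, fun n _ => ?_, fun m n hn hnm x => ?_⟩
  · ext1 x
    have := DFunLike.congr_fun (hP 0) (coc A 1 n x)
    simp only [ContinuousLinearMap.comp_apply] at this
    rw [ContinuousLinearMap.comp_apply, hQx, hQx, coc_coc, coc_self, this]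
  · ext1 x
    have := hcomm (n + 1) n x
    rwa [coc_succ_self, coc_succ_self] at this
  · have hm : 1 ≤ m := hn.trans hnm
    have hn0 : (0 : ℝ) < n := by exact_mod_cast hn
    have hr : (1 : ℝ) ≤ (m : ℝ) / n := by
      rw [one_le_div hn0]
      exact_mod_cast hnm
    have hr0 : (0 : ℝ) < (m : ℝ) / n := zero_lt_one.trans_le hr
    have hlm : Nat.log 2 n ≤ Nat.log 2 m := Nat.log_mono_right hnm
    have hexp := exp_log_two_le hlam hn hnm
    have hgrow : K * ((m : ℝ) / n) ^ a ≤ (K + M) * ((m : ℝ) / n) ^ max a (lam / Real.log 2) := by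
      gcongr
      · linarith
      · exact le_max_left _ _
    obtain ⟨hA1, hA2⟩ := hA m n hn hnm x
    refine ⟨?_, ?_, hA1.trans ?_, hA2.trans ?_⟩
    · have h1 := (near m hm (coc A (2 ^ Nat.log 2 m) n (Q n x))).1
      have h2 := (hb _ _ hlm (coc A (2 ^ Nat.log 2 n) n x)).1
      have h3 := (near n hn x).2
      rw [coc_coc] at h1
      rw [coc_dyadic, hPQ, ← hcomm, coc_coc] at h2
      exact chain _ _ _ _ _ _ h1 h2 h3 (by positivity) hexp (by positivity) (hN n hn x)
    · have h1 := (near n hn (coc A (2 ^ Nat.log 2 n) m (x - Q m x))).1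
      have h2 := (hb _ _ hlm (coc A (2 ^ Nat.log 2 m) m x)).2.1
      have h3 := (near m hm x).2
      rw [coc_coc] at h1
      rw [coc_dyadic, hPQ, ← hcommQ, coc_coc] at h2
      exact chain _ _ _ _ _ _ h1 h2 h3 (by positivity) hexp (by positivity) (hN m hm x)
    · exact mul_le_mul_of_nonneg_right hgrow (hN n hn x)
    · exact mul_le_mul_of_nonneg_right hgrow (hN m hm x)

/-- Corollary: relation between the polynomial dichotomy spectrum of
`𝔸` and the exponential dichotomy spectrum of the dyadic reparametrization `𝔹`. -/
theorem mem_sigmaPD_iff_two_rpow_mem_sigmaED {d : ℕ}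
    (A : ℕ → (EuclideanSpace ℝ (Fin d) ≃L[ℝ] EuclideanSpace ℝ (Fin d)))
    (N : ℕ → EuclideanSpace ℝ (Fin d) → ℝ)
    (hN : ∀ n : ℕ, 1 ≤ n → IsNormOn (N n))
    (K a : ℝ) (hK : 0 < K) (ha : 0 < a)
    (hbg : ∀ m n : ℕ, 1 ≤ n → n ≤ m → ∀ x : EuclideanSpace ℝ (Fin d),
      N m (coc A m n x) ≤ K * ((m : ℝ) / n) ^ a * N n x ∧
      N n (coc A n m x) ≤ K * ((m : ℝ) / n) ^ a * N m x) :
    ∀ τ : ℝ,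
      τ ∈ SigmaPD A N ↔
      (2 : ℝ) ^ τ ∈ SigmaED (fun n : ℕ => coc A (2 ^ (n + 1)) (2 ^ n))
        (fun n : ℕ => N (2 ^ n)) := by
  intro τ
  have hpos : (0 : ℝ) < (2 : ℝ) ^ τ := by positivity
  have hC : PolyBounded (fun n : ℕ => scale ((((n : ℝ) + 1) / n) ^ (-τ)) (A n)) N K (a + |τ|) :=
    PolyBounded.scale hbg hN hK τ
  simp only [SigmaPD, SigmaED, Set.mem_ofPred_eq, hpos, true_and, scale_coc_dyadic]
  exact not_congr ⟨fun h => h.dyadic, StrongExpDichotomyWRT.of_dyadic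
    (fun n hn => (hN n hn).1) hK (by positivity) hC⟩

end NonautLin
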